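/- arXiv:2208.03085 — 5 statements merged into one kernel-verified Lean document; each statement's English description precedes it below -/
import Mathlib

section
/- Let A ∈ ℝ^{n×p} and let A† ∈ ℝ^{p×n} be its Moore–Penrose inverse (i.e. AA†A = A, A†AA† = A†, (AA†)ᵀ = AA†, (A†A)ᵀ = A†A). Set B = −(A†)ᵀ. Then every complex eigenvalue of ABᵀ is a nonpositive real number (indeed Sp(ABᵀ) ⊂ {0, −1}), and for every 0 < η < 1/2 the block matrix Λ_{A,B} = [[I_n, 2ηA, 0, −ηA], [2ηBᵀ, I_p, −ηBᵀ, 0], [I_n, 0, 0, 0], [0, I_p, 0, 0]] is diagonalizable over ℂ. -/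
open Matrix Filter

noncomputable section

/-- The OGDA dynamics matrix `Λ_{A,B}` of the general-sum bilinear game
`(xᵀAy, xᵀBy)`. -/
def LamGS {n p : ℕ} (η : ℝ) (A B : Matrix (Fin n) (Fin p) ℝ) :
    Matrix ((Fin n ⊕ Fin p) ⊕ (Fin n ⊕ Fin p)) ((Fin n ⊕ Fin p) ⊕ (Fin n ⊕ Fin p)) ℝ :=
  Matrix.fromBlocks
    (Matrix.fromBlocks 1 ((2 * η) • A) ((2 * η) • Bᵀ) 1)
    (Matrix.fromBlocks 0 ((-η) • A) ((-η) • Bᵀ) 0)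
    (Matrix.fromBlocks 1 0 0 1)
    0

/-- A complex square matrix is diagonalizable iff its eigenspaces span the whole space. -/
def IsDiagonalizableC {m : Type*} [Fintype m] [DecidableEq m] (M : Matrix m m ℂ) : Prop :=
  (⨆ μ : ℂ, Module.End.eigenspace (Matrix.toLin' M) μ) = ⊤

open Polynomial in
/-- The quadratic whose roots are the eigenvalues of the OGDA dynamics on the eigenspace of the
bilinear coupling for the (rescaled) eigenvalue `e`. -/
def ogdaQuadratic (e : ℂ) : ℂ[X] := X ^ 2 - X - C e * (2 * X - 1)

open Polynomial in
lemma ogdaQuadratic_separable {e : ℂ} (he : 1 + 4 * e ^ 2 ≠ 0) :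
    (ogdaQuadratic e).Separable := by
  have hC : C (1 + 4 * e ^ 2)⁻¹ * (1 + 4 * C e ^ 2) = 1 := by
    have h : (1 + 4 * C e ^ 2 : ℂ[X]) = C (1 + 4 * e ^ 2) := by
      rw [C_add, C_mul, C_pow, C_1, C_ofNat]
    rw [h, ← C_mul, inv_mul_cancel₀ he, C_1]
  refine ⟨-4 * C (1 + 4 * e ^ 2)⁻¹, C (1 + 4 * e ^ 2)⁻¹ * (2 * X - 1 - 2 * C e), ?_⟩
  have hd : derivative (ogdaQuadratic e) = 2 * X - 1 - 2 * C e := by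
    simp [ogdaQuadratic]
    ring
  rw [hd, ogdaQuadratic]
  linear_combination hC

open Polynomial in
lemma ogdaQuadratic_isCoprime {e e' : ℂ} (h : e ≠ e') :
    IsCoprime (ogdaQuadratic e) (ogdaQuadratic e') := by
  have hC : C (e' - e)⁻¹ * (C e' - C e) = 1 := by
    rw [← C_sub, ← C_mul, inv_mul_cancel₀ (sub_ne_zero.2 h.symm), C_1]
  refine ⟨C (e' - e)⁻¹ * ((2 * X - 1) - 4 * C e'), C (e' - e)⁻¹ * (4 * C e - (2 * X - 1)), ?_⟩
  simp only [ogdaQuadratic]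
  linear_combination hC

lemma isDiagonalizableC_of_squarefree {m : Type*} [Fintype m] [DecidableEq m]
    {M : Matrix m m ℂ} {f : Polynomial ℂ} (hf : Squarefree f) (h : Polynomial.aeval M f = 0) :
    IsDiagonalizableC M := by
  have h' : Polynomial.aeval (Matrix.toLin' M) f = 0 := by
    have := Polynomial.aeval_algHom_apply (Matrix.toLinAlgEquiv' (R := ℂ) (n := m)).toAlgHom M f
    rw [h, map_zero] at this
    exact this
  have hs := (Module.End.isSemisimple_of_squarefree_aeval_eq_zero hf h').isFinitelySemisimple
  rw [IsDiagonalizableC, ← Module.End.iSup_maxGenEigenspace_eq_top (Matrix.toLin' M)]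
  exact iSup_congr fun μ => (hs.maxGenEigenspace_eq_eigenspace μ).symm

lemma spectrum_subset_of_sq_eq_neg {R : Type*} [Ring R] [Algebra ℂ R] {a : R}
    (h : a * a = -a) : spectrum ℂ a ⊆ {0, -1} := by
  nontriviality R
  intro μ hμ
  have h1 := spectrum.subset_polynomial_aeval a (Polynomial.X * Polynomial.X + Polynomial.X)
    ⟨μ, hμ, rfl⟩
  have h2 : μ * (μ + 1) = 0 := by
    simp [h] at h1
    linear_combination h1
  rcases mul_eq_zero.1 h2 with h3 | h3
  · exact Or.inl h3
  · exact Or.inr (eq_neg_of_add_eq_zero_left h3)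

lemma cubic_relation_of_commute {R : Type*} [Ring R] {L E : R} (hc : Commute E L)
    (hL : L * L - L = E * (2 * L - 1)) {t : R} (hE : E * E * E = -(t * E)) :
    (L * L - L) * (L * L - L) * (L * L - L) + t * (L * L - L) * ((2 * L - 1) * (2 * L - 1)) = 0 := by
  have hw : Commute E (2 * L - 1) :=
    ((Commute.ofNat_right E 2).mul_right hc).sub_right (Commute.one_right E)
  rw [hL]
  generalize 2 * L - 1 = w at hw
  have h1 : E * w * (E * w) * (E * w) = E * E * E * (w * w * w) := by
    have hw' : w * E = E * w := hw.eq.symm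
    simp only [mul_assoc]
    rw [← mul_assoc w E, hw', ← mul_assoc w E w, hw']
    simp only [mul_assoc]
    rw [← mul_assoc w E (w * w), hw']
    simp only [mul_assoc]
  rw [h1, hE]
  noncomm_ring

section LamGS

variable {n p : ℕ} (η : ℝ) (A B : Matrix (Fin n) (Fin p) ℝ)

/-- The coupling of the two players' dynamics, `η` times `[[0, A], [Bᵀ, 0]]`. -/
def gameCoupling : Matrix (Fin n ⊕ Fin p) (Fin n ⊕ Fin p) ℝ :=
  Matrix.fromBlocks 0 (η • A) (η • Bᵀ) 0

lemma LamGS_eq_fromBlocks_gameCoupling :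
    LamGS η A B = Matrix.fromBlocks (1 + 2 * gameCoupling η A B) (-gameCoupling η A B) 1 0 := by
  have h : Matrix.fromBlocks 1 ((2 * η) • A) ((2 * η) • Bᵀ) 1 = 1 + 2 * gameCoupling η A B := by
    rw [gameCoupling, two_mul, ← Matrix.fromBlocks_one]
    simp only [Matrix.fromBlocks_add, two_mul, add_smul, add_zero, zero_add]
  rw [LamGS, h, Matrix.fromBlocks_one]
  simp [gameCoupling, Matrix.fromBlocks_neg]

variable {A B}

lemma gameCoupling_cube (hA : A * Bᵀ * A = -A) (hB : Bᵀ * A * Bᵀ = -Bᵀ) :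
    gameCoupling η A B * gameCoupling η A B * gameCoupling η A B =
      -(η ^ 2 • gameCoupling η A B) := by
  simp only [gameCoupling, Matrix.fromBlocks_multiply, Matrix.fromBlocks_smul,
    Matrix.fromBlocks_neg]
  simp [hA, hB, smul_smul, pow_succ, mul_assoc]

lemma LamGS_cubic_relation (hA : A * Bᵀ * A = -A) (hB : Bᵀ * A * Bᵀ = -Bᵀ) :
    let L := LamGS η A B
    (L * L - L) * (L * L - L) * (L * L - L) +
      algebraMap ℝ _ (η ^ 2) * (L * L - L) * ((2 * L - 1) * (2 * L - 1)) = 0 := by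
  intro L
  have hK := gameCoupling_cube η hA hB
  have hLK : L = _ := LamGS_eq_fromBlocks_gameCoupling η A B
  generalize gameCoupling η A B = K at hK hLK
  have h1 : (1 : Matrix ((Fin n ⊕ Fin p) ⊕ (Fin n ⊕ Fin p)) _ ℝ) = Matrix.fromBlocks 1 0 0 1 :=
    Matrix.fromBlocks_one.symm
  refine cubic_relation_of_commute (E := Matrix.fromBlocks K 0 0 K) ?_ ?_ ?_
  · rw [Commute, SemiconjBy, hLK]
    simp only [Matrix.fromBlocks_multiply]
    congr 1 <;> noncomm_ring
  · simp only [hLK, two_mul, h1, Matrix.fromBlocks_multiply, Matrix.fromBlocks_add, sub_eq_add_neg,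
      Matrix.fromBlocks_neg]
    congr 1 <;> noncomm_ring
  · rw [← Algebra.smul_def]
    simp [Matrix.fromBlocks_multiply, Matrix.fromBlocks_smul, Matrix.fromBlocks_neg, hK]

lemma isDiagonalizableC_LamGS (hA : A * Bᵀ * A = -A) (hB : Bᵀ * A * Bᵀ = -Bᵀ)
    (h0 : 0 < η) (h1 : η < 1 / 2) : IsDiagonalizableC ((LamGS η A B).map Complex.ofReal) := by
  set e : ℂ := η * Complex.I with he
  have he2 : e ^ 2 = -(η : ℂ) ^ 2 := by simp [he, mul_pow]
  have he0 : e ≠ 0 := by simp [he, h0.ne']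
  have hd : 1 + 4 * e ^ 2 ≠ 0 := by
    have : (1 - 4 * η ^ 2 : ℝ) ≠ 0 := by nlinarith
    rw [he2]
    intro h
    apply this
    exact_mod_cast (by linear_combination h : (1 - 4 * η ^ 2 : ℂ) = 0)
  have hsep : (ogdaQuadratic 0 * (ogdaQuadratic e * ogdaQuadratic (-e))).Separable := by
    refine (ogdaQuadratic_separable (by simp)).mul
      ((ogdaQuadratic_separable hd).mul (ogdaQuadratic_separable (by simpa using hd))
        (ogdaQuadratic_isCoprime (self_ne_neg.2 he0)))
      ((ogdaQuadratic_isCoprime he0.symm).mul_right (ogdaQuadratic_isCoprime ?_))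
    exact (neg_ne_zero.2 he0).symm
  refine isDiagonalizableC_of_squarefree hsep.squarefree ?_
  have hpoly : ogdaQuadratic 0 * (ogdaQuadratic e * ogdaQuadratic (-e)) =
      (Polynomial.X * Polynomial.X - Polynomial.X) * (Polynomial.X * Polynomial.X - Polynomial.X)
        * (Polynomial.X * Polynomial.X - Polynomial.X) +
      Polynomial.C ((η : ℂ) ^ 2) * (Polynomial.X * Polynomial.X - Polynomial.X) *
        ((2 * Polynomial.X - 1) * (2 * Polynomial.X - 1)) := by
    have hCe : Polynomial.C e ^ 2 = -Polynomial.C ((η : ℂ) ^ 2) := by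
      rw [← Polynomial.C_pow, he2, Polynomial.C_neg]
    simp only [ogdaQuadratic, Polynomial.C_neg, Polynomial.C_0]
    linear_combination (-(Polynomial.X ^ 2 - Polynomial.X) * (2 * Polynomial.X - 1) ^ 2) * hCe
  have hL := congrArg (Complex.ofRealHom.mapMatrix) (LamGS_cubic_relation η hA hB)
  have halg : Complex.ofRealHom.mapMatrix (algebraMap ℝ (Matrix ((Fin n ⊕ Fin p) ⊕ (Fin n ⊕ Fin p))
      ((Fin n ⊕ Fin p) ⊕ (Fin n ⊕ Fin p)) ℝ) (η ^ 2)) = algebraMap ℂ _ ((η : ℂ) ^ 2) := by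
    simp [Matrix.algebraMap_eq_diagonal, Matrix.diagonal_map, Pi.algebraMap_def]
  simp only [map_add, map_mul, map_sub, map_one, map_zero, map_ofNat, halg] at hL
  rw [hpoly]
  simp only [map_add, map_mul, map_sub, map_one, map_ofNat, Polynomial.aeval_X, Polynomial.aeval_C]
  exact hL

end LamGS

/-- **Lemma (Moore–Penrose inverse and `Λ_{A,B}`).**
Let `A† = Ad` be the Moore–Penrose inverse of `A` and `B = −(A†)ᵀ`.  Then every
complex eigenvalue of `ABᵀ` is a nonpositive real (indeed `Sp(ABᵀ) ⊆ {0, −1}`) and for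
every `0 < η < 1/2` the matrix `Λ_{A,B}` is diagonalizable over `ℂ`. -/
theorem moore_penrose_LamGS_diagonalizable
    {n p : ℕ} (A : Matrix (Fin n) (Fin p) ℝ) (Ad : Matrix (Fin p) (Fin n) ℝ)
    (hAd1 : A * Ad * A = A) (hAd2 : Ad * A * Ad = Ad)
    (hAd3 : (A * Ad)ᵀ = A * Ad) (hAd4 : (Ad * A)ᵀ = Ad * A)
    (B : Matrix (Fin n) (Fin p) ℝ) (hB : B = -Adᵀ) :
    (∀ μ ∈ spectrum ℂ ((A * Bᵀ).map Complex.ofReal), μ.im = 0 ∧ μ.re ≤ 0) ∧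
    spectrum ℂ ((A * Bᵀ).map Complex.ofReal) ⊆ {0, -1} ∧
    ∀ η : ℝ, 0 < η → η < 1 / 2 →
      IsDiagonalizableC ((LamGS η A B).map Complex.ofReal) := by
  have hBt : Bᵀ = -Ad := by simp [hB]
  have hspec : spectrum ℂ ((A * Bᵀ).map Complex.ofReal) ⊆ {0, -1} := by
    apply spectrum_subset_of_sq_eq_neg
    have h : A * Bᵀ * (A * Bᵀ) = -(A * Bᵀ) := by
      simp [hBt, ← Matrix.mul_assoc, hAd1]
    have h' := congrArg Complex.ofRealHom.mapMatrix h
    rw [map_mul, map_neg] at h'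
    exact h'
  refine ⟨fun μ hμ => ?_, hspec, fun η h0 h1 => isDiagonalizableC_LamGS η ?_ ?_ h0 h1⟩
  · rcases hspec hμ with rfl | rfl <;> simp
  · simp [hBt, hAd1]
  · simp [hBt, hAd2]

end
end

section
/- Fix η > 0 and μ ≥ 0, set X = η√μ, and let S(μ) = {λ ∈ ℂ : λ²(1−λ)² + μη²(1−2λ)² = 0}. (0) If X = 0, S(μ) = {0, 1}. (1) If 0 < X < 1/2, then with δ = √(1 − 4X²), S(μ) = {λ₁, λ̄₁, λ₂, λ̄₂} has exactly 4 elements, where λ₁ = ½(1 + δ + 2iX) and λ₂ = ½(1 − δ + 2iX), and |λ₁|² = ½(1 + √(1 − 4X²)) < 1 while |λ₂|² = ½(1 − √(1 − 4X²)) < ½. (2) If X = 1/2, S(μ) = {½(1+i), ½(1−i)}. (3) If X > 1/2, then with δ = i√(4X² − 1), S(μ) = {λ₁, λ̄₁, λ₂, λ̄₂} has 4 elements with λ₁ = ½(1 + δ + 2iX), λ₂ = ½(1 − δ + 2iX), |λ₁|² = 2X² + X√(4X² − 1) and |λ₂|² = 2X² − X√(4X² − 1). -/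
open Complex

noncomputable section

/-- The factor `l²(1-l)² + X²(1-2l)²` splits into linear factors once `δ² = 1 - 4X²`. -/
theorem ogda_factor_eq_prod (X δ l : ℂ) (hδ : δ ^ 2 = 1 - 4 * X ^ 2) :
    l ^ 2 * (1 - l) ^ 2 + X ^ 2 * (1 - 2 * l) ^ 2 =
      (l - (1 + δ + 2 * X * I) / 2) * (l - (1 - δ + 2 * X * I) / 2) *
        ((l - (1 + δ - 2 * X * I) / 2) * (l - (1 - δ - 2 * X * I) / 2)) := by
  have hplus : (l - (1 + δ + 2 * X * I) / 2) * (l - (1 - δ + 2 * X * I) / 2) =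
      l ^ 2 - l - X * I * (2 * l - 1) := by
    linear_combination (-1 / 4) * hδ + X ^ 2 * I_sq
  have hminus : (l - (1 + δ - 2 * X * I) / 2) * (l - (1 - δ - 2 * X * I) / 2) =
      l ^ 2 - l + X * I * (2 * l - 1) := by
    linear_combination (-1 / 4) * hδ + X ^ 2 * I_sq
  rw [hplus, hminus]
  linear_combination X ^ 2 * (2 * l - 1) ^ 2 * I_sq

theorem ogda_factor_eq_zero_iff (X δ l : ℂ) (hδ : δ ^ 2 = 1 - 4 * X ^ 2) :
    l ^ 2 * (1 - l) ^ 2 + X ^ 2 * (1 - 2 * l) ^ 2 = 0 ↔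
      (l = (1 + δ + 2 * X * I) / 2 ∨ l = (1 - δ + 2 * X * I) / 2) ∨
        (l = (1 + δ - 2 * X * I) / 2 ∨ l = (1 - δ - 2 * X * I) / 2) := by
  simp only [ogda_factor_eq_prod X δ l hδ, mul_eq_zero, sub_eq_zero]

theorem Set.ncard_eq_four_of_ne {α : Type*} {a b c d : α} (hab : a ≠ b) (hac : a ≠ c)
    (had : a ≠ d) (hbc : b ≠ c) (hbd : b ≠ d) (hcd : c ≠ d) :
    ({a, b, c, d} : Set α).ncard = 4 := by
  rw [Set.ncard_insert_of_notMem (by simp [hab, hac, had]),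
    Set.ncard_insert_of_notMem (by simp [hbc, hbd]), Set.ncard_pair hcd]

/-- **Lemma (roots of `λ²(1−λ)² + μη²(1−2λ)²`).**
For `η > 0`, `μ ≥ 0` and `X = η√μ`, the root set
`S(μ) = {λ ∈ ℂ : λ²(1−λ)² + μη²(1−2λ)² = 0}` is described as follows:
if `X = 0` it is `{0,1}`; if `0 < X < 1/2` it consists of the 4 distinct points
`λ₁, λ̄₁, λ₂, λ̄₂` with `λ₁ = ½(1+δ+2iX)`, `λ₂ = ½(1−δ+2iX)`, `δ = √(1−4X²)`, with
`|λ₁|² = ½(1+√(1−4X²)) < 1` and `|λ₂|² = ½(1−√(1−4X²)) < ½`; if `X = 1/2` it is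
`{½(1+i), ½(1−i)}`; and if `X > 1/2` it consists of the 4 distinct points
`λ₁, λ̄₁, λ₂, λ̄₂` with `δ = i√(4X²−1)`, `|λ₁|² = 2X² + X√(4X²−1)` and
`|λ₂|² = 2X² − X√(4X²−1)`. -/
theorem roots_of_ogda_characteristic_factor
    (η μ X : ℝ) (hη : 0 < η) (hμ : 0 ≤ μ) (hX : X = η * Real.sqrt μ)
    (S : Set ℂ)
    (hS : S = {l : ℂ | l ^ 2 * (1 - l) ^ 2 + (μ : ℂ) * (η : ℂ) ^ 2 * (1 - 2 * l) ^ 2 = 0}) :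
    (X = 0 → S = {0, 1}) ∧
    (0 < X → X < 1 / 2 →
      ∀ δ l1 l2 : ℂ, δ = ((Real.sqrt (1 - 4 * X ^ 2) : ℝ) : ℂ) →
        l1 = (1 + δ + 2 * (X : ℂ) * Complex.I) / 2 →
        l2 = (1 - δ + 2 * (X : ℂ) * Complex.I) / 2 →
        S = {l1, (starRingEnd ℂ) l1, l2, (starRingEnd ℂ) l2} ∧ S.ncard = 4 ∧
        ‖l1‖ ^ 2 = (1 + Real.sqrt (1 - 4 * X ^ 2)) / 2 ∧ ‖l1‖ ^ 2 < 1 ∧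
        ‖l2‖ ^ 2 = (1 - Real.sqrt (1 - 4 * X ^ 2)) / 2 ∧ ‖l2‖ ^ 2 < 1 / 2) ∧
    (X = 1 / 2 → S = {(1 + Complex.I) / 2, (1 - Complex.I) / 2}) ∧
    (1 / 2 < X →
      ∀ δ l1 l2 : ℂ, δ = Complex.I * ((Real.sqrt (4 * X ^ 2 - 1) : ℝ) : ℂ) →
        l1 = (1 + δ + 2 * (X : ℂ) * Complex.I) / 2 →
        l2 = (1 - δ + 2 * (X : ℂ) * Complex.I) / 2 →
        S = {l1, (starRingEnd ℂ) l1, l2, (starRingEnd ℂ) l2} ∧ S.ncard = 4 ∧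
        ‖l1‖ ^ 2 = 2 * X ^ 2 + X * Real.sqrt (4 * X ^ 2 - 1) ∧
        ‖l2‖ ^ 2 = 2 * X ^ 2 - X * Real.sqrt (4 * X ^ 2 - 1)) := by
  have hXsq : (μ : ℂ) * (η : ℂ) ^ 2 = (X : ℂ) ^ 2 := by
    have h : μ * η ^ 2 = X ^ 2 := by rw [hX, mul_pow, Real.sq_sqrt hμ, mul_comm]
    exact_mod_cast h
  rw [hXsq] at hS
  refine ⟨?_, ?_, ?_, ?_⟩
  · intro h0
    ext l
    rw [hS, Set.mem_ofPred_eq, ogda_factor_eq_zero_iff X 1 l (by simp [h0])]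
    norm_num [h0]
    tauto
  · intro hpos hlt δ l1 l2 hδ hl1 hl2
    have hnonneg : 0 < 1 - 4 * X ^ 2 := by nlinarith
    set s := Real.sqrt (1 - 4 * X ^ 2)
    have hs : s ^ 2 = 1 - 4 * X ^ 2 := Real.sq_sqrt hnonneg.le
    have hs0 : 0 < s := Real.sqrt_pos.2 hnonneg
    have hs1 : s < 1 := by nlinarith
    have hδsq : δ ^ 2 = 1 - 4 * (X : ℂ) ^ 2 := by rw [hδ]; exact_mod_cast hs
    have hc1 : (starRingEnd ℂ) l1 = (1 + δ - 2 * (X : ℂ) * I) / 2 := by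
      simp [hl1, hδ, sub_eq_add_neg, map_ofNat]
    have hc2 : (starRingEnd ℂ) l2 = (1 - δ - 2 * (X : ℂ) * I) / 2 := by
      simp [hl2, hδ, sub_eq_add_neg, map_ofNat]
    have hre1 : l1.re = (1 + s) / 2 := by simp [hl1, hδ]
    have him1 : l1.im = X := by simp [hl1, hδ]
    have hre2 : l2.re = (1 - s) / 2 := by simp [hl2, hδ]
    have him2 : l2.im = X := by simp [hl2, hδ]
    have hset : S = {l1, (starRingEnd ℂ) l1, l2, (starRingEnd ℂ) l2} := by
      ext l
      rw [hS, Set.mem_ofPred_eq, ogda_factor_eq_zero_iff X δ l hδsq, ← hl1, ← hl2, ← hc1, ← hc2]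
      simp only [Set.mem_insert_iff, Set.mem_singleton_iff]
      tauto
    have hn1 : ‖l1‖ ^ 2 = (1 + s) / 2 := by
      rw [Complex.sq_norm, normSq_apply, hre1, him1]
      linarith
    have hn2 : ‖l2‖ ^ 2 = (1 - s) / 2 := by
      rw [Complex.sq_norm, normSq_apply, hre2, him2]
      linarith
    refine ⟨hset, ?_, hn1, by linarith, hn2, by linarith⟩
    rw [hset]
    apply Set.ncard_eq_four_of_ne <;> rw [Ne, Complex.ext_iff] <;>
      simp only [conj_re, conj_im, hre1, hre2, him1, him2] <;> rintro ⟨hre, him⟩ <;> linarith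
  · intro hhalf
    ext l
    rw [hS, Set.mem_ofPred_eq, ogda_factor_eq_zero_iff X 0 l (by norm_num [hhalf])]
    norm_num [hhalf]
  · intro hgt δ l1 l2 hδ hl1 hl2
    have hnonneg : 0 < 4 * X ^ 2 - 1 := by nlinarith
    set s := Real.sqrt (4 * X ^ 2 - 1)
    have hs : s ^ 2 = 4 * X ^ 2 - 1 := Real.sq_sqrt hnonneg.le
    have hs0 : 0 < s := Real.sqrt_pos.2 hnonneg
    have hs1 : s < 2 * X := by nlinarith
    have hδsq : δ ^ 2 = 1 - 4 * (X : ℂ) ^ 2 := by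
      have h : (s : ℂ) ^ 2 = 4 * (X : ℂ) ^ 2 - 1 := by exact_mod_cast hs
      rw [hδ, mul_pow, I_sq, h]
      ring
    have hc1 : (starRingEnd ℂ) l1 = (1 - δ - 2 * (X : ℂ) * I) / 2 := by
      simp [hl1, hδ, sub_eq_add_neg, map_ofNat]
    have hc2 : (starRingEnd ℂ) l2 = (1 + δ - 2 * (X : ℂ) * I) / 2 := by
      simp [hl2, hδ, sub_eq_add_neg, map_ofNat]
    have hre1 : l1.re = 1 / 2 := by simp [hl1, hδ]
    have him1 : l1.im = (2 * X + s) / 2 := by simp [hl1, hδ, add_comm]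
    have hre2 : l2.re = 1 / 2 := by simp [hl2, hδ]
    have him2 : l2.im = (2 * X - s) / 2 := by simp [hl2, hδ]; ring
    have hset : S = {l1, (starRingEnd ℂ) l1, l2, (starRingEnd ℂ) l2} := by
      ext l
      rw [hS, Set.mem_ofPred_eq, ogda_factor_eq_zero_iff X δ l hδsq, ← hl1, ← hl2, ← hc1, ← hc2]
      simp only [Set.mem_insert_iff, Set.mem_singleton_iff]
      tauto
    refine ⟨hset, ?_, ?_, ?_⟩
    · rw [hset]
      apply Set.ncard_eq_four_of_ne <;> rw [Ne, Complex.ext_iff] <;>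
        simp only [conj_re, conj_im, hre1, hre2, him1, him2] <;> rintro ⟨-, him⟩ <;> linarith
    · rw [Complex.sq_norm, normSq_apply, hre1, him1]
      linarith
    · rw [Complex.sq_norm, normSq_apply, hre2, him2]
      linarith

end
end

section
/- Let A ∈ ℝ^{n×p}, η > 0, and let Λ be the 2(n+p)×2(n+p) block matrix [[I_n, 2ηA, 0, −ηA], [−2ηAᵀ, I_p, ηAᵀ, 0], [I_n, 0, 0, 0], [0, I_p, 0, 0]] encoding the zero-sum OGDA for xᵀAy. Then the set of complex eigenvalues of Λ equals the union over μ ∈ Sp(AᵀA) ∪ Sp(AAᵀ) of the sets S(μ) = {λ ∈ ℂ : λ²(1−λ)² + μη²(1−2λ)² = 0}. -/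
open Matrix Filter

noncomputable section

/-- The OGDA dynamics matrix `Λ` of the zero-sum bilinear game `xᵀAy`:
`[[I_n, 2ηA, 0, −ηA], [−2ηAᵀ, I_p, ηAᵀ, 0], [I_n, 0, 0, 0], [0, I_p, 0, 0]]`. -/
def LamZS {n p : ℕ} (η : ℝ) (A : Matrix (Fin n) (Fin p) ℝ) :
    Matrix ((Fin n ⊕ Fin p) ⊕ (Fin n ⊕ Fin p)) ((Fin n ⊕ Fin p) ⊕ (Fin n ⊕ Fin p)) ℝ :=
  Matrix.fromBlocks
    (Matrix.fromBlocks 1 ((2 * η) • A) ((-(2 * η)) • Aᵀ) 1)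
    (Matrix.fromBlocks 0 ((-η) • A) (η • Aᵀ) 0)
    (Matrix.fromBlocks 1 0 0 1)
    0

theorem Matrix.mem_spectrum_iff_exists_mulVec_eq_smul {K ι : Type*} [Field K] [Fintype ι]
    [DecidableEq ι] (M : Matrix ι ι K) (l : K) :
    l ∈ spectrum K M ↔ ∃ v, v ≠ 0 ∧ M *ᵥ v = l • v := by
  rw [← Matrix.spectrum_toLin', ← Module.End.hasEigenvalue_iff_mem_spectrum]
  constructor
  · intro h
    obtain ⟨v, hv⟩ := h.exists_hasEigenvector
    exact ⟨v, hv.2, by simpa using hv.apply_eq_smul⟩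
  · rintro ⟨v, hv, h⟩
    exact Module.End.hasEigenvalue_of_hasEigenvector
      (x := v) ⟨Module.End.mem_eigenspace_iff.2 (by simpa using h), hv⟩

/-- An eigenvector of `Λ` has the form `(l x, l y, x, y)`. -/
theorem mem_spectrum_LamZS_iff {n p : ℕ} (η : ℝ) (A : Matrix (Fin n) (Fin p) ℝ) (l : ℂ) :
    l ∈ spectrum ℂ ((LamZS η A).map Complex.ofReal) ↔
      ∃ x y, (x ≠ 0 ∨ y ≠ 0) ∧
        (l ^ 2 - l) • x = ((η : ℂ) * (2 * l - 1)) • (A.map Complex.ofReal *ᵥ y) ∧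
        (l ^ 2 - l) • y = (-((η : ℂ) * (2 * l - 1))) • ((A.map Complex.ofReal)ᵀ *ᵥ x) := by
  have hΛ : (LamZS η A).map Complex.ofReal = Matrix.fromBlocks
      (Matrix.fromBlocks 1 ((2 * η : ℂ) • A.map Complex.ofReal)
        ((-(2 * η) : ℂ) • (A.map Complex.ofReal)ᵀ) 1)
      (Matrix.fromBlocks 0 ((-η : ℂ) • A.map Complex.ofReal)
        ((η : ℂ) • (A.map Complex.ofReal)ᵀ) 0)
      (Matrix.fromBlocks 1 0 0 1) 0 := by
    ext (( i | i ) | (i | i)) ((j | j) | (j | j)) <;>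
      simp [LamZS, Matrix.one_apply, apply_ite Complex.ofReal]
  rw [Matrix.mem_spectrum_iff_exists_mulVec_eq_smul, hΛ]
  generalize A.map Complex.ofReal = B
  constructor
  · rintro ⟨v, hv, h⟩
    obtain ⟨x', y', x, y, rfl⟩ : ∃ x' y' x y, v = Sum.elim (Sum.elim x' y') (Sum.elim x y) :=
      ⟨fun i => v (.inl (.inl i)), fun i => v (.inl (.inr i)), fun i => v (.inr (.inl i)),
        fun i => v (.inr (.inr i)), by ext ((i | i) | (i | i)) <;> rfl⟩
    simp only [Matrix.fromBlocks_mulVec, Sum.elim_comp_inl, Sum.elim_comp_inr, ← Sum.elim_add_add,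
      Matrix.one_mulVec, Matrix.zero_mulVec, zero_add, add_zero, Matrix.smul_mulVec] at h
    have h1 : x' = l • x := by
      ext i; simpa using congrFun h (.inr (.inl i))
    have h2 : y' = l • y := by
      ext i; simpa using congrFun h (.inr (.inr i))
    subst h1 h2
    refine ⟨x, y, ?_, ?_, ?_⟩
    · by_contra! hxy
      obtain ⟨rfl, rfl⟩ := hxy
      exact hv (by ext ((i | i) | (i | i)) <;> simp)
    · ext i
      have := congrFun h (.inl (.inl i))
      simp [Matrix.mulVec_smul] at this ⊢
      linear_combination -this
    · ext i
      have := congrFun h (.inl (.inr i))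
      simp [Matrix.mulVec_smul] at this ⊢
      linear_combination -this
  · rintro ⟨x, y, hxy, h1, h2⟩
    refine ⟨Sum.elim (Sum.elim (l • x) (l • y)) (Sum.elim x y), ?_, ?_⟩
    · intro h
      rcases hxy with hx | hy
      · exact hx (by ext i; simpa using congrFun h (.inr (.inl i)))
      · exact hy (by ext i; simpa using congrFun h (.inr (.inr i)))
    · simp only [Matrix.fromBlocks_mulVec, Sum.elim_comp_inl, Sum.elim_comp_inr,
        Matrix.one_mulVec, Matrix.zero_mulVec, zero_add, add_zero, Matrix.smul_mulVec]
      ext ((i | i) | (i | i))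
      · have := congrFun h1 i
        simp [Matrix.mulVec_smul] at this ⊢
        linear_combination -this
      · have := congrFun h2 i
        simp [Matrix.mulVec_smul] at this ⊢
        linear_combination -this
      · simp
      · simp

section BlockSystem

variable {K m n : Type*} [Field K] [Fintype m] [Fintype n] [DecidableEq m]

/-- If `c x = d B y` and `c y = e C x` with `d e ≠ 0` and `x ≠ 0`, then `B C` has an eigenvalue `μ`
with `c² = μ d e`. -/
theorem Matrix.exists_mem_spectrum_mul {B : Matrix m n K} {C : Matrix n m K} {c d e : K}
    (hde : d * e ≠ 0) {x : m → K} {y : n → K} (hx : x ≠ 0)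
    (h1 : c • x = d • (B *ᵥ y)) (h2 : c • y = e • (C *ᵥ x)) :
    ∃ μ ∈ spectrum K (B * C), c ^ 2 = μ * (d * e) := by
  refine ⟨c ^ 2 / (d * e), ?_, (div_mul_cancel₀ _ hde).symm⟩
  rw [Matrix.mem_spectrum_iff_exists_mulVec_eq_smul]
  refine ⟨x, hx, ?_⟩
  have h : c ^ 2 • x = (d * e) • ((B * C) *ᵥ x) := by
    rw [sq, mul_smul, h1, smul_comm, ← Matrix.mulVec_smul, h2, Matrix.mulVec_smul,
      Matrix.mulVec_mulVec, smul_smul]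
  rw [div_eq_inv_mul, mul_smul, h, smul_smul, inv_mul_cancel₀ hde, one_smul]

/-- If `μ` is an eigenvalue of `B C` and `c² = μ d e` with `d e ≠ 0`, then the system
`c x = d B y`, `c y = e C x` has a nonzero solution. -/
theorem Matrix.exists_ne_zero_of_mem_spectrum_mul {B : Matrix m n K} {C : Matrix n m K}
    {c d e μ : K} (hde : d * e ≠ 0) (hμ : μ ∈ spectrum K (B * C)) (h : c ^ 2 = μ * (d * e)) :
    ∃ x y, (x ≠ 0 ∨ y ≠ 0) ∧ c • x = d • (B *ᵥ y) ∧ c • y = e • (C *ᵥ x) := by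
  rw [Matrix.mem_spectrum_iff_exists_mulVec_eq_smul] at hμ
  obtain ⟨x, hx, hxμ⟩ := hμ
  by_cases hc : c = 0
  · subst hc
    obtain rfl : μ = 0 := by simpa [hde] using h.symm
    by_cases hCx : C *ᵥ x = 0
    · exact ⟨x, 0, .inl hx, by simp, by simp [hCx]⟩
    · exact ⟨0, C *ᵥ x, .inr hCx, by simp [Matrix.mulVec_mulVec, hxμ], by simp⟩
  · refine ⟨x, (e / c) • (C *ᵥ x), .inl hx, ?_, ?_⟩
    · rw [Matrix.mulVec_smul, Matrix.mulVec_mulVec, hxμ, smul_smul, smul_smul]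
      congr 1
      field_simp
      linear_combination h
    · rw [smul_smul, mul_div_cancel₀ _ hc]

end BlockSystem

/-- **Lemma (spectrum of the zero-sum OGDA matrix).**
The set of complex eigenvalues of `Λ` equals the union, over
`μ ∈ Sp(AᵀA) ∪ Sp(AAᵀ)`, of the sets `S(μ) = {λ ∈ ℂ : λ²(1−λ)² + μη²(1−2λ)² = 0}`. -/
theorem spectrum_LamZS
    {n p : ℕ} (η : ℝ) (hη : 0 < η) (A : Matrix (Fin n) (Fin p) ℝ) :
    spectrum ℂ ((LamZS η A).map Complex.ofReal) =
      ⋃ μ ∈ (spectrum ℂ ((Aᵀ * A).map Complex.ofReal) ∪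
              spectrum ℂ ((A * Aᵀ).map Complex.ofReal)),
        {l : ℂ | l ^ 2 * (1 - l) ^ 2 + μ * (η : ℂ) ^ 2 * (1 - 2 * l) ^ 2 = 0} := by
  have hη' : (η : ℂ) ≠ 0 := Complex.ofReal_ne_zero.2 hη.ne'
  have hmap₁ : (Aᵀ * A).map Complex.ofReal =
      (A.map Complex.ofReal)ᵀ * A.map Complex.ofReal :=
    Matrix.map_mul (f := Complex.ofRealHom)
  have hmap₂ : (A * Aᵀ).map Complex.ofReal =
      A.map Complex.ofReal * (A.map Complex.ofReal)ᵀ :=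
    Matrix.map_mul (f := Complex.ofRealHom)
  ext l
  rw [mem_spectrum_LamZS_iff, hmap₁, hmap₂]
  generalize A.map Complex.ofReal = B
  simp only [Set.mem_iUnion, Set.mem_ofPred_eq, exists_prop]
  by_cases hl : 2 * l - 1 = 0
  · obtain rfl : l = 1 / 2 := by linear_combination hl / 2
    constructor
    · rintro ⟨x, y, hxy, h1, h2⟩
      norm_num at h1 h2
      simp [h1, h2] at hxy
    · rintro ⟨μ, -, h⟩
      norm_num at h
  · have hd : (η : ℂ) * (2 * l - 1) ≠ 0 := mul_ne_zero hη' hl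
    have hd₁ := mul_ne_zero hd (neg_ne_zero.2 hd)
    have hd₂ := mul_ne_zero (neg_ne_zero.2 hd) hd
    constructor
    · rintro ⟨x, y, hx | hy, h1, h2⟩
      · obtain ⟨μ, hμ, h⟩ := Matrix.exists_mem_spectrum_mul hd₁ hx h1 h2
        exact ⟨μ, .inr hμ, by linear_combination h⟩
      · obtain ⟨μ, hμ, h⟩ := Matrix.exists_mem_spectrum_mul hd₂ hy h2 h1
        exact ⟨μ, .inl hμ, by linear_combination h⟩
    · rintro ⟨μ, hμ | hμ, h⟩
      · obtain ⟨y, x, hyx, h2, h1⟩ := Matrix.exists_ne_zero_of_mem_spectrum_mul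
          (c := l ^ 2 - l) hd₂ hμ (by linear_combination h)
        exact ⟨x, y, hyx.symm, h1, h2⟩
      · exact Matrix.exists_ne_zero_of_mem_spectrum_mul hd₁ hμ (by linear_combination h)

end
end

section
/- Let A ∈ ℝ^{n×p} with A ≠ 0 and η > 0, let Λ be the zero-sum OGDA block matrix [[I_n, 2ηA, 0, −ηA], [−2ηAᵀ, I_p, ηAᵀ, 0], [I_n, 0, 0, 0], [0, I_p, 0, 0]], and for each complex eigenvalue λ of Λ let E_λ = Ker(Λ − λI) ⊂ ℂ^{2(n+p)}. Then the sum over all eigenvalues λ of dim E_λ equals 2(n+p) − 2·dim Ker(AᵀA − (1/(4η²))·I_p). In particular, Λ is diagonalizable over ℂ if and only if 1/(4η²) ∉ Sp(AᵀA) ∪ Sp(AAᵀ). -/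
open Matrix Filter

noncomputable section

open Module Module.End in
theorem finite_support_finrank_eigenspace {K V : Type*} [Field K] [AddCommGroup V] [Module K V]
    [FiniteDimensional K V] (f : End K V) :
    (Function.support fun μ => finrank K (eigenspace f μ)).Finite :=
  (WellFoundedGT.finite_ne_bot_of_iSupIndep f.eigenspaces_iSupIndep).subset fun _ hμ h =>
    hμ (Submodule.finrank_eq_zero.mpr h)

open Module Module.End in
/-- The dimensions of the eigenspaces of `f` add up to the dimension of their span. -/
theorem finsum_finrank_eigenspace {K V : Type*} [Field K] [AddCommGroup V] [Module K V]
    [FiniteDimensional K V] (f : End K V) :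
    ∑ᶠ μ, finrank K (eigenspace f μ) = finrank K (⨆ μ, eigenspace f μ : Submodule K V) := by
  classical
  have hfin := finite_support_finrank_eigenspace f
  have hsup (s : Finset K) :
      finrank K (s.sup (eigenspace f) : Submodule K V) = ∑ μ ∈ s, finrank K (eigenspace f μ) := by
    induction s using Finset.induction_on with
    | empty => simp
    | insert a s ha ih =>
      have hdisj : Disjoint (eigenspace f a) (s.sup (eigenspace f)) := by
        rw [Finset.sup_eq_iSup]
        exact f.eigenspaces_iSupIndep.disjoint_biSup (y := ↑s) (by simpa using ha)
      rw [Finset.sup_insert, Finset.sum_insert ha, ← ih, ← Submodule.finrank_sup_add_finrank_inf_eq,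
        hdisj.eq_bot, finrank_bot, add_zero]
  rw [finsum_eq_sum _ hfin, ← hsup]
  refine congrArg (fun W : Submodule K V => finrank K W) ?_
  refine le_antisymm (Finset.sup_le fun μ _ => le_iSup (eigenspace f) μ) (iSup_le fun μ => ?_)
  by_cases hμ : finrank K (eigenspace f μ) = 0
  · simp [Submodule.finrank_eq_zero.mp hμ]
  · exact Finset.le_sup (f := eigenspace f) (by simpa using hμ)

theorem mem_eigenspace_toLin'_iff {R m : Type*} [CommRing R] [Fintype m] [DecidableEq m]
    (M : Matrix m m R) (μ : R) (v : m → R) :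
    v ∈ Module.End.eigenspace (toLin' M) μ ↔ M *ᵥ v = μ • v := by
  rw [Module.End.mem_eigenspace_iff, toLin'_apply]

/-- A skew-Hermitian matrix is diagonalizable. -/
theorem isDiagonalizableC_of_conjTranspose_eq_neg {m : Type*} [Fintype m] [DecidableEq m]
    {K : Matrix m m ℂ} (hK : Kᴴ = -K) : IsDiagonalizableC K := by
  have hH : (Complex.I • K).IsHermitian := by
    rw [IsHermitian, conjTranspose_smul, hK]
    simp
  let b := hH.eigenvectorBasis.toBasis.map (WithLp.linearEquiv 2 ℂ (m → ℂ))
  rw [IsDiagonalizableC, eq_top_iff, ← b.span_eq, Submodule.span_le]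
  rintro _ ⟨j, rfl⟩
  refine Submodule.mem_iSup_of_mem (-Complex.I * hH.eigenvalues j) ?_
  rw [mem_eigenspace_toLin'_iff]
  have h := congrArg (fun v => -Complex.I • v) (hH.mulVec_eigenvectorBasis j)
  simp only [smul_mulVec, smul_smul, neg_mul, Complex.I_mul_I, neg_neg, one_smul] at h
  simp only [b, Module.Basis.map_apply, OrthonormalBasis.coe_toBasis, WithLp.linearEquiv_apply]
  refine h.trans ?_
  ext i
  simp [mul_assoc]

/-- The optimistic gradient dynamics matrix of the linear vector field `K`. -/
def ogdaMatrix {m : Type*} [DecidableEq m] (η : ℂ) (K : Matrix m m ℂ) :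
    Matrix (m ⊕ m) (m ⊕ m) ℂ :=
  fromBlocks (1 + (2 * η) • K) (-(η • K)) 1 0

section ogdaMatrix

variable {m : Type*} [Fintype m] [DecidableEq m] {η : ℂ} {K : Matrix m m ℂ}

theorem mem_eigenspace_ogdaMatrix_iff (l : ℂ) (v : m ⊕ m → ℂ) :
    v ∈ Module.End.eigenspace (toLin' (ogdaMatrix η K)) l ↔
      v ∘ Sum.inl = l • (v ∘ Sum.inr) ∧
      (η * (2 * l - 1)) • K *ᵥ (v ∘ Sum.inr) = (l * (l - 1)) • (v ∘ Sum.inr) := by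
  obtain ⟨x, y, rfl⟩ : ∃ x y, v = Sum.elim x y := ⟨_, _, (Sum.elim_comp_inl_inr v).symm⟩
  have hsmul : l • Sum.elim x y = Sum.elim (l • x) (l • y) := by
    ext (i | i) <;> rfl
  rw [mem_eigenspace_toLin'_iff, ogdaMatrix, fromBlocks_mulVec, hsmul, Sum.elim_eq_iff]
  simp only [Sum.elim_comp_inl, Sum.elim_comp_inr, add_mulVec, one_mulVec, zero_mulVec, add_zero,
    smul_mulVec, neg_mulVec]
  rw [and_comm]
  refine and_congr_right ?_
  rintro rfl
  simp only [mulVec_smul, smul_smul, funext_iff, Pi.add_apply, Pi.neg_apply, Pi.smul_apply,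
    smul_eq_mul]
  refine forall_congr' fun i => ⟨fun h => ?_, fun h => ?_⟩ <;> linear_combination h

theorem eigenspace_ogdaMatrix_half :
    Module.End.eigenspace (toLin' (ogdaMatrix η K)) (1 / 2) = ⊥ := by
  refine (Submodule.eq_bot_iff _).mpr fun v hv => ?_
  obtain ⟨h₁, h₂⟩ := (mem_eigenspace_ogdaMatrix_iff _ _).mp hv
  have h₃ : v ∘ Sum.inr = 0 := by
    norm_num at h₂
    exact h₂
  rw [h₃, smul_zero] at h₁
  ext (i | i)
  · exact congrFun h₁ i
  · exact congrFun h₃ i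

theorem finrank_eigenspace_ogdaMatrix (hη : η ≠ 0) {l s : ℂ} (hl : l ≠ 1 / 2)
    (hs : l * (l - 1) = η * s * (2 * l - 1)) :
    Module.finrank ℂ (Module.End.eigenspace (toLin' (ogdaMatrix η K)) l) =
      Module.finrank ℂ (Module.End.eigenspace (toLin' K) s) := by
  have hl' : η * (2 * l - 1) ≠ 0 :=
    mul_ne_zero hη fun h => hl (by linear_combination h / 2)
  have key (w : m → ℂ) : (η * (2 * l - 1)) • K *ᵥ w = (l * (l - 1)) • w ↔ K *ᵥ w = s • w := by
    rw [hs, show η * s * (2 * l - 1) = η * (2 * l - 1) * s by ring, mul_smul (η * (2 * l - 1)) s]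
    exact (smul_right_injective (m → ℂ) hl').eq_iff
  refine LinearEquiv.finrank_eq
    { toFun := fun v => ⟨v.1 ∘ Sum.inr, ?_⟩
      invFun := fun w => ⟨Sum.elim (l • w.1) w.1, ?_⟩
      map_add' := fun _ _ => rfl
      map_smul' := fun _ _ => rfl
      left_inv := fun v => ?_
      right_inv := fun w => rfl }
  · rw [mem_eigenspace_toLin'_iff, ← key]
    exact ((mem_eigenspace_ogdaMatrix_iff _ _).mp v.2).2
  · rw [mem_eigenspace_ogdaMatrix_iff]
    exact ⟨rfl, (key _).mpr ((mem_eigenspace_toLin'_iff _ _ _).mp w.2)⟩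
  · ext (i | i)
    · exact (congrFun ((mem_eigenspace_ogdaMatrix_iff _ _).mp v.2).1 i).symm
    · rfl

/-- The eigenvalues of the dynamics matrix lying over an eigenvalue `s` of `K` are the roots of
`l (l - 1) = η s (2 l - 1)`; there are two of them, unless `s = ± I / (2 η)`. -/
theorem exists_finset_roots (hη : η ≠ 0) (s : ℂ) :
    ∃ R : Finset ℂ, (∀ l, l ∈ R ↔ l * (l - 1) = η * s * (2 * l - 1)) ∧
      R.card + ((if s = Complex.I / (2 * η) then 1 else 0) +
        (if s = -(Complex.I / (2 * η)) then 1 else 0)) = 2 := by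
  obtain ⟨d, hd⟩ := IsAlgClosed.exists_eq_mul_self (1 + 4 * η ^ 2 * s ^ 2)
  have hroots (l : ℂ) : l * (l - 1) = η * s * (2 * l - 1) ↔
      l = (1 + 2 * η * s + d) / 2 ∨ l = (1 + 2 * η * s - d) / 2 := by
    rw [← sub_eq_zero, ← sub_eq_zero (b := (1 + 2 * η * s + d) / 2),
      ← sub_eq_zero (b := (1 + 2 * η * s - d) / 2), ← mul_eq_zero]
    refine Eq.congr_left ?_
    linear_combination (-1 / 4 : ℂ) * hd
  refine ⟨{(1 + 2 * η * s + d) / 2, (1 + 2 * η * s - d) / 2}, fun l => by simp [hroots], ?_⟩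
  have hI : Complex.I / (2 * η) ≠ 0 := by simp [hη]
  have hne : Complex.I / (2 * η) ≠ -(Complex.I / (2 * η)) := fun h => hI (self_eq_neg.mp h)
  have hd0 : d = 0 ↔ s = Complex.I / (2 * η) ∨ s = -(Complex.I / (2 * η)) := by
    rw [← sq_eq_sq_iff_eq_or_eq_neg, ← mul_self_eq_zero, ← hd, div_pow, Complex.I_sq,
      eq_div_iff (by simp [hη])]
    constructor <;> intro h <;> linear_combination h
  by_cases hd' : d = 0
  · rcases hd0.mp hd' with h | h
    · simp [hd', h, hne]
    · simp [hd', h, hne.symm]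
  · rw [Finset.card_pair fun h => hd' (by linear_combination h)]
    rw [hd0, not_or] at hd'
    simp [hd'.1, hd'.2]

open Module Module.End in
theorem finsum_finrank_eigenspace_ogdaMatrix (hη : η ≠ 0) (hK : IsDiagonalizableC K) :
    ∑ᶠ l, finrank ℂ (eigenspace (toLin' (ogdaMatrix η K)) l) +
      (finrank ℂ (eigenspace (toLin' K) (Complex.I / (2 * η))) +
        finrank ℂ (eigenspace (toLin' K) (-(Complex.I / (2 * η))))) = 2 * Fintype.card m := by
  classical
  choose R hR hcard using exists_finset_roots (η := η) hη
  set g : ℂ → ℕ := fun s => finrank ℂ (eigenspace (toLin' K) s)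
  have hhalf {s : ℂ} : (1 / 2 : ℂ) ∉ R s := by
    rw [hR]
    norm_num
  have hfin : g.support.Finite := finite_support_finrank_eigenspace (toLin' K)
  have htot : ∑ s ∈ hfin.toFinset, g s = Fintype.card m := by
    rw [← finsum_eq_sum g hfin, finsum_finrank_eigenspace, show _ = ⊤ from hK, finrank_top,
      finrank_fintype_fun_eq_card]
  have hval {s l : ℂ} (h : l ∈ R s) :
      finrank ℂ (eigenspace (toLin' (ogdaMatrix η K)) l) = g s :=
    finrank_eigenspace_ogdaMatrix hη (fun h' => hhalf (h' ▸ h)) ((hR s l).mp h)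
  have hdisj : (hfin.toFinset : Set ℂ).PairwiseDisjoint R := by
    intro s _ t _ hst
    refine Finset.disjoint_left.mpr fun l hs ht => hst ?_
    have hl : η * (2 * l - 1) ≠ 0 :=
      mul_ne_zero hη fun h => hhalf (s := s) (by
        rwa [show (1 / 2 : ℂ) = l by linear_combination -h / 2])
    refine mul_left_cancel₀ hl ?_
    linear_combination (hR t l).mp ht - (hR s l).mp hs
  have hsupp : (Function.support fun l => finrank ℂ (eigenspace (toLin' (ogdaMatrix η K)) l)) ⊆
      (hfin.toFinset.biUnion R : Finset ℂ) := by
    intro l hl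
    have hl' : l ≠ 1 / 2 := by
      rintro rfl
      exact hl (Submodule.finrank_eq_zero.mpr eigenspace_ogdaMatrix_half)
    have hl'' : 2 * l - 1 ≠ 0 := fun h => hl' (by linear_combination h / 2)
    have hmem : l ∈ R (l * (l - 1) / (η * (2 * l - 1))) := by
      rw [hR, mul_right_comm, mul_div_cancel₀ _ (mul_ne_zero hη hl'')]
    rw [Finset.mem_coe, Finset.mem_biUnion]
    refine ⟨_, ?_, hmem⟩
    rw [Set.Finite.mem_toFinset, Function.mem_support, ← hval hmem]
    exact hl
  have hite (t : ℂ) : ∑ s ∈ hfin.toFinset, (if s = t then 1 else 0) * g s = g t := by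
    simp only [ite_mul, one_mul, zero_mul, Finset.sum_ite_eq', Set.Finite.mem_toFinset,
      Function.mem_support, ite_not]
    grind
  rw [finsum_eq_sum_of_support_subset _ hsupp, Finset.sum_biUnion hdisj,
    Finset.sum_congr rfl fun s _ => Finset.sum_congr (s₁ := R s) rfl fun l hl => hval hl]
  change _ + (g _ + g _) = _
  rw [← hite (Complex.I / (2 * η)), ← hite (-(Complex.I / (2 * η))), ← Finset.sum_add_distrib,
    ← Finset.sum_add_distrib, ← htot, Finset.mul_sum]
  refine Finset.sum_congr rfl fun s _ => ?_
  rw [Finset.sum_const, smul_eq_mul, ← hcard s]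
  ring

end ogdaMatrix

theorem finrank_eigenspace_fromBlocks_skew {m₁ m₂ : Type*} [Fintype m₁] [DecidableEq m₁]
    [Fintype m₂] [DecidableEq m₂] (A : Matrix m₁ m₂ ℂ) (B : Matrix m₂ m₁ ℂ) {s : ℂ} (hs : s ≠ 0) :
    Module.finrank ℂ (Module.End.eigenspace (toLin' (fromBlocks 0 A (-B) 0)) s) =
      Module.finrank ℂ (Module.End.eigenspace (toLin' (B * A)) (-s ^ 2)) := by
  have key (v : m₁ ⊕ m₂ → ℂ) : v ∈ Module.End.eigenspace (toLin' (fromBlocks 0 A (-B) 0)) s ↔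
      v ∘ Sum.inl = s⁻¹ • A *ᵥ (v ∘ Sum.inr) ∧
      v ∘ Sum.inr ∈ Module.End.eigenspace (toLin' (B * A)) (-s ^ 2) := by
    obtain ⟨x, y, rfl⟩ : ∃ x y, v = Sum.elim x y := ⟨_, _, (Sum.elim_comp_inl_inr v).symm⟩
    have hsmul : s • Sum.elim x y = Sum.elim (s • x) (s • y) := by
      ext (i | i) <;> rfl
    rw [mem_eigenspace_toLin'_iff, mem_eigenspace_toLin'_iff, fromBlocks_mulVec, hsmul,
      Sum.elim_eq_iff]
    simp only [Sum.elim_comp_inl, Sum.elim_comp_inr, zero_mulVec, zero_add, add_zero, neg_mulVec]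
    rw [eq_inv_smul_iff₀ hs, eq_comm (a := A *ᵥ y)]
    refine and_congr_right fun h => ?_
    rw [← mulVec_mulVec, ← h, mulVec_smul, show -s ^ 2 = s * -s by ring, mul_smul,
      smul_right_inj hs, neg_smul, neg_eq_iff_eq_neg]
  refine LinearEquiv.finrank_eq
    { toFun := fun v => ⟨v.1 ∘ Sum.inr, ((key _).mp v.2).2⟩
      invFun := fun w => ⟨Sum.elim (s⁻¹ • A *ᵥ w.1) w.1, (key _).mpr ⟨rfl, w.2⟩⟩
      map_add' := fun _ _ => rfl
      map_smul' := fun _ _ => rfl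
      left_inv := fun v => ?_
      right_inv := fun w => rfl }
  ext (i | i)
  · exact (congrFun ((key _).mp v.2).1 i).symm
  · rfl

theorem mem_spectrum_iff_finrank_eigenspace_ne_zero {m : Type*} [Fintype m] [DecidableEq m]
    (M : Matrix m m ℂ) (c : ℂ) :
    c ∈ spectrum ℂ M ↔ Module.finrank ℂ (Module.End.eigenspace (toLin' M) c) ≠ 0 := by
  rw [← spectrum_toLin', ← Module.End.hasEigenvalue_iff_mem_spectrum, Module.End.hasEigenvalue_iff,
    Ne, Ne, Submodule.finrank_eq_zero]

theorem mem_spectrum_mul_of_mem_spectrum_mul {m₁ m₂ : Type*} [Fintype m₁] [DecidableEq m₁]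
    [Fintype m₂] [DecidableEq m₂] (A : Matrix m₁ m₂ ℂ) (B : Matrix m₂ m₁ ℂ) {c : ℂ} (hc : c ≠ 0)
    (h : c ∈ spectrum ℂ (A * B)) : c ∈ spectrum ℂ (B * A) := by
  rw [← spectrum_toLin', ← Module.End.hasEigenvalue_iff_mem_spectrum] at h ⊢
  obtain ⟨v, hv, hv0⟩ := h.exists_hasEigenvector
  rw [mem_eigenspace_toLin'_iff, ← mulVec_mulVec] at hv
  refine Module.End.hasEigenvalue_of_hasEigenvector (x := B *ᵥ v) ⟨?_, fun h0 => hv0 ?_⟩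
  · rw [mem_eigenspace_toLin'_iff, ← mulVec_mulVec, hv, mulVec_smul]
  · rw [h0, mulVec_zero] at hv
    exact (smul_eq_zero.mp hv.symm).resolve_left hc

theorem map_LamZS {n p : ℕ} (η : ℝ) (A : Matrix (Fin n) (Fin p) ℝ) :
    (LamZS η A).map Complex.ofReal =
      ogdaMatrix η (fromBlocks 0 (A.map Complex.ofReal) (-(A.map Complex.ofReal)ᵀ) 0) := by
  ext ((i | i) | (i | i)) ((j | j) | (j | j)) <;>
    simp [LamZS, ogdaMatrix, one_apply, apply_ite Complex.ofReal]

/-- **Lemma (total dimension of the eigenspaces of `Λ`).**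
For `A ≠ 0` and `η > 0`, the sum over all complex eigenvalues `λ` of `Λ` of
`dim E_λ` equals `2(n+p) − 2·dim Ker(AᵀA − (1/(4η²))·I)`; in particular `Λ` is
diagonalizable over `ℂ` iff `1/(4η²) ∉ Sp(AᵀA) ∪ Sp(AAᵀ)`. -/
theorem sum_dim_eigenspaces_LamZS
    {n p : ℕ} (A : Matrix (Fin n) (Fin p) ℝ) (hA : A ≠ 0) (η : ℝ) (hη : 0 < η) :
    (∑ᶠ l : ℂ, Module.finrank ℂ
        (Module.End.eigenspace (Matrix.toLin' ((LamZS η A).map Complex.ofReal)) l)) =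
      2 * (n + p) - 2 * Module.finrank ℂ (LinearMap.ker (Matrix.toLin'
        ((Aᵀ * A).map Complex.ofReal - (((1 / (4 * η ^ 2) : ℝ)) : ℂ) • 1))) ∧
    (IsDiagonalizableC ((LamZS η A).map Complex.ofReal) ↔
      (((1 / (4 * η ^ 2) : ℝ)) : ℂ) ∉
        (spectrum ℂ ((Aᵀ * A).map Complex.ofReal) ∪
         spectrum ℂ ((A * Aᵀ).map Complex.ofReal))) := by
  set Ac : Matrix (Fin n) (Fin p) ℂ := A.map Complex.ofReal with hAc
  set c : ℂ := ((1 / (4 * η ^ 2) : ℝ) : ℂ) with hc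
  have hη' : (η : ℂ) ≠ 0 := by exact_mod_cast hη.ne'
  have hc0 : c ≠ 0 := by
    rw [hc]
    exact_mod_cast (by positivity : 1 / (4 * η ^ 2) ≠ 0)
  have hAtA : (Aᵀ * A).map Complex.ofReal = Acᵀ * Ac := Matrix.map_mul (f := Complex.ofRealHom)
  have hAAt : (A * Aᵀ).map Complex.ofReal = Ac * Acᵀ := Matrix.map_mul (f := Complex.ofRealHom)
  have hskew : (fromBlocks 0 Ac (-Acᵀ) 0)ᴴ = -fromBlocks 0 Ac (-Acᵀ) 0 := by
    ext (i | i) (j | j) <;> simp [hAc]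
  have hker : LinearMap.ker (toLin' (Acᵀ * Ac - c • 1)) =
      Module.End.eigenspace (toLin' (Acᵀ * Ac)) c := by
    ext v
    rw [mem_eigenspace_toLin'_iff, LinearMap.mem_ker, toLin'_apply, sub_mulVec, smul_mulVec,
      one_mulVec, sub_eq_zero]
  have hs : Complex.I / (2 * (η : ℂ)) ≠ 0 := by simp [hη']
  have hsq : -(Complex.I / (2 * (η : ℂ))) ^ 2 = c := by
    rw [div_pow, Complex.I_sq, hc]
    push_cast
    ring
  have hsum := finsum_finrank_eigenspace_ogdaMatrix hη'
    (isDiagonalizableC_of_conjTranspose_eq_neg hskew)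
  rw [finrank_eigenspace_fromBlocks_skew _ _ hs,
    finrank_eigenspace_fromBlocks_skew _ _ (neg_ne_zero.mpr hs), neg_sq, hsq, ← map_LamZS,
    Fintype.card_sum, Fintype.card_fin, Fintype.card_fin] at hsum
  rw [hAtA, hAAt, hker]
  refine ⟨by omega, ?_⟩
  have hspec : c ∈ spectrum ℂ (Acᵀ * Ac) ∪ spectrum ℂ (Ac * Acᵀ) ↔ c ∈ spectrum ℂ (Acᵀ * Ac) :=
    ⟨fun h => h.elim id (mem_spectrum_mul_of_mem_spectrum_mul _ _ hc0), Or.inl⟩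
  rw [hspec, mem_spectrum_iff_finrank_eigenspace_ne_zero, not_not, IsDiagonalizableC,
    Submodule.eq_top_iff_finrank_eq, ← finsum_finrank_eigenspace,
    Module.finrank_fintype_fun_eq_card]
  simp only [Fintype.card_sum, Fintype.card_fin]
  omega

end
end

section
/- Let A ∈ ℝ^{n×p} with A ≠ 0, let μ_max be the largest eigenvalue of AAᵀ and μ_min the smallest positive eigenvalue of AAᵀ, and let 0 < η < 1/√(3μ_max). Define λ_max = max{λ*, λ**} with λ* = 1_{μ_min ≤ 1/(4η²)} √(½(1 + √(1 − 4η²μ_min))) and λ** = 1_{μ_max ≥ 1/(4η²)} √(2η²μ_max + η√μ_max √(4η²μ_max − 1)). Then there exist a real initialization Z₀ = (x₀, y₀, x₋₁, y₋₁) ∈ ℝ^{2(n+p)} and a constant c > 0 such that the zero-sum OGDA iterates Z_t = (x_t, y_t, x_{t−1}, y_{t−1}) satisfy ‖Z_t − Z_∞‖ > c·λ_max^t for all t, where Z_∞ is the limit of Z_t. In particular the geometric ratio λ_max in the convergence bound of OGDA is optimal. -/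
open Matrix Filter

noncomputable section

/-- Squared Euclidean norm of a vector in `ℝ^n`. -/
def sqnorm {n : ℕ} (v : Fin n → ℝ) : ℝ := ∑ i, (v i) ^ 2

theorem sqnorm_eq_dotProduct {n : ℕ} (v : Fin n → ℝ) : sqnorm v = v ⬝ᵥ v := by
  simp [sqnorm, dotProduct, sq]

theorem sqnorm_smul {n : ℕ} (a : ℝ) (v : Fin n → ℝ) : sqnorm (a • v) = a ^ 2 * sqnorm v := by
  simp [sqnorm, Finset.mul_sum, mul_pow]

theorem sqnorm_pos {n : ℕ} {v : Fin n → ℝ} (hv : v ≠ 0) : 0 < sqnorm v := by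
  rw [sqnorm_eq_dotProduct]
  exact lt_of_le_of_ne (Finset.sum_nonneg fun i _ => mul_self_nonneg (v i))
    fun h => hv (dotProduct_self_eq_zero.mp h.symm)

/-- A positive eigenvalue `μ` of `A * Aᵀ` yields a pair of singular vectors of equal norm. -/
theorem exists_singular_pair {n p : ℕ} (A : Matrix (Fin n) (Fin p) ℝ) {μ : ℝ} (hμ : 0 < μ)
    (h : μ ∈ spectrum ℝ (A * Aᵀ)) :
    ∃ (v : Fin n → ℝ) (u : Fin p → ℝ), v ≠ 0 ∧ A *ᵥ u = √μ • v ∧ Aᵀ *ᵥ v = √μ • u ∧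
      sqnorm u = sqnorm v := by
  have hs : √μ ≠ 0 := (Real.sqrt_pos.mpr hμ).ne'
  have hss : √μ * √μ = μ := Real.mul_self_sqrt hμ.le
  rw [← Matrix.spectrum_toLin', ← Module.End.hasEigenvalue_iff_mem_spectrum] at h
  obtain ⟨v, hv⟩ := h.exists_hasEigenvector
  have hAv : A *ᵥ (Aᵀ *ᵥ v) = μ • v := by
    simpa [Matrix.mulVec_mulVec] using hv.apply_eq_smul
  have h1 : A *ᵥ ((√μ)⁻¹ • (Aᵀ *ᵥ v)) = √μ • v := by
    rw [Matrix.mulVec_smul, hAv, smul_smul]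
    congr 1
    field_simp
    linarith
  have h2 : Aᵀ *ᵥ v = √μ • ((√μ)⁻¹ • (Aᵀ *ᵥ v)) := (smul_inv_smul₀ hs _).symm
  refine ⟨v, (√μ)⁻¹ • (Aᵀ *ᵥ v), hv.2, h1, h2, ?_⟩
  generalize (√μ)⁻¹ • (Aᵀ *ᵥ v) = u at h1 h2
  have h3 : (Aᵀ *ᵥ v) ⬝ᵥ u = v ⬝ᵥ (A *ᵥ u) := by
    rw [Matrix.mulVec_transpose, Matrix.dotProduct_mulVec]
  rw [h1, h2, smul_dotProduct, dotProduct_smul] at h3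
  rw [sqnorm_eq_dotProduct, sqnorm_eq_dotProduct]
  exact mul_left_cancel₀ hs h3

/-- The OGDA characteristic polynomial for `σ ≤ 1/2`: its dominant root. -/
theorem exists_root_of_four_mul_sq_le_one {σ : ℝ} (hσ : 0 < σ) (h : 4 * σ ^ 2 ≤ 1) :
    ∃ z : ℂ, z ^ 2 = z - 2 * σ * Complex.I * z + σ * Complex.I ∧
      ‖z‖ = √((1 + √(1 - 4 * σ ^ 2)) / 2) ∧ ‖z‖ < 1 := by
  have hr : √(1 - 4 * σ ^ 2) ^ 2 = 1 - 4 * σ ^ 2 := Real.sq_sqrt (by linarith)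
  have hr1 : √(1 - 4 * σ ^ 2) < 1 := by
    rw [Real.sqrt_lt' one_pos]
    nlinarith
  generalize √(1 - 4 * σ ^ 2) = r at hr hr1
  have hn : ‖(⟨(1 + r) / 2, -σ⟩ : ℂ)‖ = √((1 + r) / 2) := by
    rw [Complex.norm_eq_sqrt_sq_add_sq]
    congr 1
    linear_combination hr / 4
  refine ⟨⟨(1 + r) / 2, -σ⟩, ?_, hn, ?_⟩
  · apply Complex.ext
    · simp [sq]
      linear_combination hr / 4
    · simp [sq]
      ring
  · rw [hn, Real.sqrt_lt' one_pos]
    linarith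

/-- The OGDA characteristic polynomial for `σ ≥ 1/2`: its dominant root. -/
theorem exists_root_of_one_le_four_mul_sq {σ : ℝ} (h : 1 ≤ 4 * σ ^ 2)
    (h3 : 3 * σ ^ 2 < 1) :
    ∃ z : ℂ, z ^ 2 = z - 2 * σ * Complex.I * z + σ * Complex.I ∧
      ‖z‖ = √(2 * σ ^ 2 + σ * √(4 * σ ^ 2 - 1)) ∧ ‖z‖ < 1 := by
  have hr : √(4 * σ ^ 2 - 1) ^ 2 = 4 * σ ^ 2 - 1 := Real.sq_sqrt (by linarith)
  generalize √(4 * σ ^ 2 - 1) = r at hr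
  have hn : ‖(⟨1 / 2, -σ - r / 2⟩ : ℂ)‖ = √(2 * σ ^ 2 + σ * r) := by
    rw [Complex.norm_eq_sqrt_sq_add_sq]
    congr 1
    linear_combination hr / 4
  refine ⟨⟨1 / 2, -σ - r / 2⟩, ?_, hn, ?_⟩
  · apply Complex.ext
    · simp [sq]
      linear_combination -hr / 4
    · simp [sq]
      ring
  · rw [hn, Real.sqrt_lt' one_pos]
    nlinarith [sq_nonneg (σ - r)]

/-- The coordinates of a geometric solution of the complex scalar recursion. -/
theorem re_im_pow_succ_succ {z : ℂ} {σ : ℝ}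
    (hz : z ^ 2 = z - 2 * σ * Complex.I * z + σ * Complex.I) (k : ℕ) :
    (z ^ (k + 2)).re = (z ^ (k + 1)).re + 2 * σ * (z ^ (k + 1)).im - σ * (z ^ k).im ∧
    (z ^ (k + 2)).im = (z ^ (k + 1)).im - 2 * σ * (z ^ (k + 1)).re + σ * (z ^ k).re := by
  have h : z ^ (k + 2) = z ^ (k + 1) - ((2 * σ : ℝ) : ℂ) * (Complex.I * z ^ (k + 1)) +
      (σ : ℂ) * (Complex.I * z ^ k) := by
    push_cast
    linear_combination z ^ k * hz
  constructor
  · rw [h, Complex.add_re, Complex.sub_re, Complex.re_ofReal_mul, Complex.re_ofReal_mul,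
      Complex.I_mul_re, Complex.I_mul_re]
    ring
  · rw [h, Complex.add_im, Complex.sub_im, Complex.im_ofReal_mul, Complex.im_ofReal_mul,
      Complex.I_mul_im, Complex.I_mul_im]

/-- `lmax` is the modulus of a characteristic root attached to a positive eigenvalue. -/
theorem exists_eigenvalue_root {S : Set ℝ} {μmax μmin η lmax : ℝ}
    (hμmax : IsGreatest S μmax) (hμmin : IsLeast {μ ∈ S | 0 < μ} μmin)
    (hη0 : 0 < η) (hη1 : η < 1 / √(3 * μmax))
    (hlmax : lmax = max
      (if μmin ≤ 1 / (4 * η ^ 2) then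
        √((1 + √(1 - 4 * η^2 * μmin)) / 2) else 0)
      (if 1 / (4 * η ^ 2) ≤ μmax then
        √(2 * η^2 * μmax + η * √μmax * √(4 * η^2 * μmax - 1))
        else 0)) :
    ∃ μ ∈ S, 0 < μ ∧ ∃ z : ℂ,
      z ^ 2 = z - 2 * (η * √μ : ℝ) * Complex.I * z + (η * √μ : ℝ) * Complex.I ∧
      ‖z‖ = lmax ∧ ‖z‖ < 1 := by
  have hmin0 : 0 < μmin := hμmin.1.2
  have hle : μmin ≤ μmax := hμmax.2 hμmin.1.1
  have hmax0 : 0 < μmax := hmin0.trans_le hle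
  have h3 : 3 * (η ^ 2 * μmax) < 1 := by
    rw [lt_div_iff₀ (Real.sqrt_pos.mpr (by positivity))] at hη1
    have := mul_self_lt_mul_self (by positivity) hη1
    rw [mul_mul_mul_comm, Real.mul_self_sqrt (by positivity)] at this
    linarith
  have hsq : ∀ μ, 0 < μ → (η * √μ) ^ 2 = η ^ 2 * μ := fun μ hμ => by
    rw [mul_pow, Real.sq_sqrt hμ.le]
  have hsmall : ∀ μ, μ ≤ 1 / (4 * η ^ 2) ↔ 4 * (η ^ 2 * μ) ≤ 1 := fun μ => by
    rw [le_div_iff₀ (by positivity)]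
    ring_nf
  have hlarge : ∀ μ, 1 / (4 * η ^ 2) ≤ μ ↔ 1 ≤ 4 * (η ^ 2 * μ) := fun μ => by
    rw [div_le_iff₀ (by positivity)]
    ring_nf
  have lower (h : μmin ≤ 1 / (4 * η ^ 2))
      (hl : lmax = √((1 + √(1 - 4 * η^2 * μmin)) / 2)) : ∃ μ ∈ S, 0 < μ ∧ ∃ z : ℂ,
      z ^ 2 = z - 2 * (η * √μ : ℝ) * Complex.I * z + (η * √μ : ℝ) * Complex.I ∧
      ‖z‖ = lmax ∧ ‖z‖ < 1 := by
    obtain ⟨z, hz, hn, h1⟩ := exists_root_of_four_mul_sq_le_one (σ := η * √μmin)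
      (by positivity) (by rw [hsq _ hmin0]; exact (hsmall _).mp h)
    refine ⟨μmin, hμmin.1.1, hmin0, z, hz, ?_, h1⟩
    rw [hn, hl, hsq _ hmin0, ← mul_assoc]
  have upper (h : 1 / (4 * η ^ 2) ≤ μmax)
      (hl : lmax = √(2 * η^2 * μmax + η * √μmax * √(4 * η^2 * μmax - 1))) :
      ∃ μ ∈ S, 0 < μ ∧ ∃ z : ℂ,
      z ^ 2 = z - 2 * (η * √μ : ℝ) * Complex.I * z + (η * √μ : ℝ) * Complex.I ∧
      ‖z‖ = lmax ∧ ‖z‖ < 1 := by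
    obtain ⟨z, hz, hn, h1⟩ := exists_root_of_one_le_four_mul_sq (σ := η * √μmax)
      (by rw [hsq _ hmax0]; exact (hlarge _).mp h) (by rw [hsq _ hmax0]; exact h3)
    refine ⟨μmax, hμmax.1, hmax0, z, hz, ?_, h1⟩
    rw [hn, hl, hsq _ hmax0, ← mul_assoc, ← mul_assoc]
  by_cases ha : μmin ≤ 1 / (4 * η ^ 2)
  · by_cases hb : 1 / (4 * η ^ 2) ≤ μmax
    · rw [if_pos ha, if_pos hb] at hlmax
      rcases max_choice (√((1 + √(1 - 4 * η^2 * μmin)) / 2))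
        (√(2 * η^2 * μmax + η * √μmax * √(4 * η^2 * μmax - 1))) with h | h
      · exact lower ha (hlmax.trans h)
      · exact upper hb (hlmax.trans h)
    · rw [if_pos ha, if_neg hb, max_eq_left (Real.sqrt_nonneg _)] at hlmax
      exact lower ha hlmax
  · have hb : 1 / (4 * η ^ 2) ≤ μmax := (not_le.mp ha).le.trans hle
    rw [if_neg ha, if_pos hb, max_eq_right (Real.sqrt_nonneg _)] at hlmax
    exact upper hb hlmax

/-- **Lemma (optimality of the geometric ratio `λ_max`).**
For `A ≠ 0` and `0 < η < 1/√(3μ_max)`, there exist a real initialization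
`Z₀ = (x₀, y₀, x₋₁, y₋₁)` and a constant `c > 0` such that the OGDA iterates
`Z_t = (x_t, y_t, x_{t−1}, y_{t−1})`, which converge to a limit `Z_∞ = (x_∞, y_∞, x_∞, y_∞)`,
satisfy `‖Z_t − Z_∞‖ > c·λ_max^t` for all `t ≥ 0`; hence the ratio `λ_max` of the
convergence bound for OGDA is optimal. -/
theorem ogda_zero_sum_rate_optimal
    {n p : ℕ} (A : Matrix (Fin n) (Fin p) ℝ) (hA : A ≠ 0)
    (μmax μmin : ℝ)
    (hμmax : IsGreatest (spectrum ℝ (A * Aᵀ)) μmax)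
    (hμmin : IsLeast {μ ∈ spectrum ℝ (A * Aᵀ) | 0 < μ} μmin)
    (η : ℝ) (hη0 : 0 < η) (hη1 : η < 1 / Real.sqrt (3 * μmax))
    (lmax : ℝ)
    (hlmax : lmax = max
      (if μmin ≤ 1 / (4 * η ^ 2) then
        Real.sqrt ((1 + Real.sqrt (1 - 4 * η^2 * μmin)) / 2) else 0)
      (if 1 / (4 * η ^ 2) ≤ μmax then
        Real.sqrt (2 * η^2 * μmax + η * Real.sqrt μmax * Real.sqrt (4 * η^2 * μmax - 1))
        else 0)) :
    ∃ (x : ℕ → Fin n → ℝ) (y : ℕ → Fin p → ℝ) (xm1 : Fin n → ℝ) (ym1 : Fin p → ℝ)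
      (xinf : Fin n → ℝ) (yinf : Fin p → ℝ) (c : ℝ),
      x 1 = x 0 + (2 * η) • (A *ᵥ y 0) - η • (A *ᵥ ym1) ∧
      y 1 = y 0 - (2 * η) • (Aᵀ *ᵥ x 0) + η • (Aᵀ *ᵥ xm1) ∧
      (∀ t, x (t + 2) = x (t + 1) + (2 * η) • (A *ᵥ y (t + 1)) - η • (A *ᵥ y t)) ∧
      (∀ t, y (t + 2) = y (t + 1) - (2 * η) • (Aᵀ *ᵥ x (t + 1)) + η • (Aᵀ *ᵥ x t)) ∧
      0 < c ∧
      Tendsto (fun t => (x t, y t)) atTop (nhds (xinf, yinf)) ∧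
      c < Real.sqrt (sqnorm (x 0 - xinf) + sqnorm (y 0 - yinf) +
            sqnorm (xm1 - xinf) + sqnorm (ym1 - yinf)) ∧
      ∀ t, c * lmax ^ (t + 1) <
        Real.sqrt (sqnorm (x (t + 1) - xinf) + sqnorm (y (t + 1) - yinf) +
          sqnorm (x t - xinf) + sqnorm (y t - yinf)) := by
  obtain ⟨μ, hμS, hμ, z, hz, hzn, hz1⟩ := exists_eigenvalue_root hμmax hμmin hη0 hη1 hlmax
  obtain ⟨v, u, hv, hAu, hAv, huv⟩ := exists_singular_pair A hμ hμS
  have hS : 0 < sqnorm v := sqnorm_pos hv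
  have hσ : 0 < η * √μ := by positivity
  have hl : 0 < lmax := by
    rw [← hzn, norm_pos_iff]
    rintro rfl
    simp [Complex.ext_iff, hη0.ne', (Real.sqrt_pos.mpr hμ).ne'] at hz
  have hstep := re_im_pow_succ_succ hz
  have hxrec (k : ℕ) : (z ^ (k + 2)).re • v = (z ^ (k + 1)).re • v +
      (2 * η) • (A *ᵥ ((z ^ (k + 1)).im • u)) - η • (A *ᵥ ((z ^ k).im • u)) := by
    rw [(hstep k).1, Matrix.mulVec_smul, Matrix.mulVec_smul, hAu]
    module
  have hyrec (k : ℕ) : (z ^ (k + 2)).im • u = (z ^ (k + 1)).im • u -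
      (2 * η) • (Aᵀ *ᵥ ((z ^ (k + 1)).re • v)) + η • (Aᵀ *ᵥ ((z ^ k).re • v)) := by
    rw [(hstep k).2, Matrix.mulVec_smul, Matrix.mulVec_smul, hAv]
    module
  have hdist (k : ℕ) : sqnorm ((z ^ (k + 1)).re • v - 0) + sqnorm ((z ^ (k + 1)).im • u - 0) +
      sqnorm ((z ^ k).re • v - 0) + sqnorm ((z ^ k).im • u - 0) =
      ((lmax ^ (k + 1)) ^ 2 + (lmax ^ k) ^ 2) * sqnorm v := by
    have hk (j : ℕ) : (lmax ^ j) ^ 2 = (z ^ j).re ^ 2 + (z ^ j).im ^ 2 := by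
      rw [← hzn, ← norm_pow, Complex.sq_norm, Complex.normSq_apply]
      ring
    simp only [sub_zero, sqnorm_smul, huv, hk]
    ring
  have hbound (k : ℕ) : √(sqnorm v) * lmax ^ k <
      √(((lmax ^ (k + 1)) ^ 2 + (lmax ^ k) ^ 2) * sqnorm v) := by
    apply Real.lt_sqrt_of_sq_lt
    rw [mul_pow, Real.sq_sqrt hS.le]
    have : 0 < (lmax ^ (k + 1)) ^ 2 * sqnorm v := by positivity
    linarith
  have htends : Tendsto (fun t : ℕ => z ^ (t + 1)) atTop (nhds 0) :=
    (tendsto_add_atTop_iff_nat 1).mpr (tendsto_pow_atTop_nhds_zero_of_norm_lt_one hz1)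
  refine ⟨fun t => (z ^ (t + 1)).re • v, fun t => (z ^ (t + 1)).im • u, (z ^ 0).re • v,
    (z ^ 0).im • u, 0, 0, √(sqnorm v), hxrec 0, hyrec 0, fun t => hxrec (t + 1),
    fun t => hyrec (t + 1), Real.sqrt_pos.mpr hS, ?_, ?_, fun t => ?_⟩
  · have hcont : Continuous fun w : ℂ => (w.re • v, w.im • u) := by fun_prop
    simpa [Function.comp_def] using (hcont.tendsto 0).comp htends
  · have h0 := hbound 0
    rw [← hdist 0, pow_zero lmax, mul_one] at h0
    exact h0
  · simpa only [hdist (t + 1)] using hbound (t + 1)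

end
end
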